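/- Let n, T be positive integers, X an n×T real matrix (rows are covariates), ε ∈ ℝ^T, α ∈ ℝ^n, and y = X'α + ε. Let L(β) = (1/(2T))‖y − X'β‖₂² be the quadratic loss. Let ℓ : ℝ^n → ℝ be a norm (nonnegative, absolutely homogeneous, satisfying the triangle inequality, vanishing only at 0), let A be a linear subspace of ℝ^n with Euclidean orthogonal complement A⊥, and assume ℓ is decomposable with respect to (A, A⊥), i.e. ℓ(a + b) = ℓ(a) + ℓ(b) for all a ∈ A, b ∈ A⊥. Assume the true coefficient vector α lies in A. Let ℓ* denote the dual norm of ℓ and Ψ(A) = sup{ℓ(u)/‖u‖₂ : u ∈ A, u ≠ 0} the subspace compatibility constant. Suppose λ > 0 satisfies λ ≥ 2ℓ*((1/T)Xε), and suppose L is strongly convex with parameter γ > 0, i.e. L(b) − L(a) ≥ ∇L(a)'(b − a) + (γ/2)‖b − a‖₂² for all a, b ∈ ℝ^n. Then any minimizer α̂ of β ↦ L(β) + λℓ(β) satisfies ‖α̂ − α‖₂ ≤ 3(λ/γ)Ψ(A). -/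

import Mathlib

open Finset

/-- The Euclidean (`ℓ₂`) norm of a vector in `Fin k → ℝ`. -/
noncomputable def e2norm {k : ℕ} (v : Fin k → ℝ) : ℝ := Real.sqrt (∑ i, v i ^ 2)

section Norm

variable {V : Type*} [AddCommGroup V] [Module ℝ V] {p : V → ℝ}

theorem map_zero_of_smul_eq_abs_mul (hp_smul : ∀ (c : ℝ) (v), p (c • v) = |c| * p v) :
    p 0 = 0 := by
  simpa using hp_smul 0 0

/-- On a finite-dimensional real space every linear functional is bounded by a multiple of any
given norm. -/
theorem exists_linear_le_mul_norm [FiniteDimensional ℝ V] (hp_nonneg : ∀ v, 0 ≤ p v)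
    (hp_smul : ∀ (c : ℝ) (v), p (c • v) = |c| * p v) (hp_add : ∀ v w, p (v + w) ≤ p v + p w)
    (hp_eq_zero : ∀ v, p v = 0 → v = 0) (f : V →ₗ[ℝ] ℝ) : ∃ C, ∀ u, f u ≤ C * p u := by
  let _ : Norm V := ⟨p⟩
  have core : NormedSpace.Core ℝ V :=
    { norm_nonneg := hp_nonneg
      norm_smul := hp_smul
      norm_triangle := hp_add
      norm_eq_zero_iff := fun v =>
        ⟨hp_eq_zero v, fun h => h ▸ map_zero_of_smul_eq_abs_mul hp_smul⟩ }
  let _ : NormedAddCommGroup V := NormedAddCommGroup.ofCore core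
  let _ : NormedSpace ℝ V := NormedSpace.ofCore core
  exact ⟨‖LinearMap.toContinuousLinearMap f‖, fun u =>
    (le_abs_self _).trans ((LinearMap.toContinuousLinearMap f).le_opNorm u)⟩

end Norm

theorem e2norm_nonneg {k : ℕ} (v : Fin k → ℝ) : 0 ≤ e2norm v := Real.sqrt_nonneg _

theorem e2norm_sq {k : ℕ} (v : Fin k → ℝ) : e2norm v ^ 2 = ∑ i, v i ^ 2 :=
  Real.sq_sqrt (Finset.sum_nonneg fun i _ => sq_nonneg (v i))

theorem abs_apply_le_e2norm {k : ℕ} (v : Fin k → ℝ) (i : Fin k) : |v i| ≤ e2norm v :=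
  Real.abs_le_sqrt (Finset.single_le_sum (f := fun i => v i ^ 2)
    (fun i _ => sq_nonneg (v i)) (Finset.mem_univ i))

theorem e2norm_pos {k : ℕ} {v : Fin k → ℝ} (hv : v ≠ 0) : 0 < e2norm v := by
  obtain ⟨i, hi⟩ := Function.ne_iff.mp hv
  exact (abs_pos.mpr hi).trans_le (abs_apply_le_e2norm v i)

theorem e2norm_le_e2norm_add {k : ℕ} {a b : Fin k → ℝ} (h : ∑ i, a i * b i = 0) :
    e2norm a ≤ e2norm (a + b) := by
  refine Real.sqrt_le_sqrt ?_
  have hsum : ∑ i, (a + b) i ^ 2 = ∑ i, a i ^ 2 + 2 * ∑ i, a i * b i + ∑ i, b i ^ 2 := by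
    rw [Finset.mul_sum, ← Finset.sum_add_distrib, ← Finset.sum_add_distrib]
    exact Finset.sum_congr rfl fun i _ => by simp only [Pi.add_apply]; ring
  have hb : 0 ≤ ∑ i, b i ^ 2 := Finset.sum_nonneg fun i _ => sq_nonneg (b i)
  linarith

/-- A norm on `ℝᵏ` is dominated by a multiple of the Euclidean norm. -/
theorem exists_norm_le_mul_e2norm {k : ℕ} {p : (Fin k → ℝ) → ℝ} (hp_nonneg : ∀ v, 0 ≤ p v)
    (hp_smul : ∀ (c : ℝ) (v), p (c • v) = |c| * p v) (hp_add : ∀ v w, p (v + w) ≤ p v + p w) :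
    ∃ C, ∀ u, p u ≤ C * e2norm u := by
  refine ⟨∑ i, p (Pi.single i 1), fun u => ?_⟩
  have hu : u = ∑ i, u i • (Pi.single i 1 : Fin k → ℝ) := pi_eq_sum_univ' u
  calc p u = p (∑ i, u i • (Pi.single i 1 : Fin k → ℝ)) := congrArg p hu
    _ ≤ ∑ i, p (u i • (Pi.single i 1 : Fin k → ℝ)) :=
      Finset.le_sum_of_subadditive p (map_zero_of_smul_eq_abs_mul hp_smul).le hp_add _ _
    _ ≤ ∑ i, p (Pi.single i 1) * e2norm u := by
      refine Finset.sum_le_sum fun i _ => ?_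
      rw [hp_smul, mul_comm]
      exact mul_le_mul_of_nonneg_left (abs_apply_le_e2norm u i) (hp_nonneg _)
    _ = _ := (Finset.sum_mul ..).symm

/-- Orthogonal decomposition of a vector of `ℝᵏ` along a subspace. -/
theorem exists_add_mem_forall_sum_mul_eq_zero {k : ℕ} (A : Submodule ℝ (Fin k → ℝ))
    (v : Fin k → ℝ) : ∃ a ∈ A, ∃ b, (∀ c ∈ A, ∑ i, c i * b i = 0) ∧ v = a + b := by
  let e := WithLp.linearEquiv 2 ℝ (Fin k → ℝ)
  obtain ⟨a, ha, b, hb, hab⟩ :=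
    (A.comap e.toLinearMap).exists_add_mem_mem_orthogonal (WithLp.toLp 2 v)
  refine ⟨e a, ha, e b, fun c hc => ?_, congrArg e hab⟩
  have h := (Submodule.mem_orthogonal _ _).mp hb (WithLp.toLp 2 c) hc
  simpa [PiLp.inner_apply, mul_comm, e] using h

/-- non-asymptotic estimation error bound for penalized regressions
(Proposition 1, after Negahban et al.). -/
theorem penalized_regression_error_bound
    (n T : ℕ) (hn : 0 < n) (hT : 0 < T)
    (X : Matrix (Fin n) (Fin T) ℝ) (ε : Fin T → ℝ) (α : Fin n → ℝ)
    (y : Fin T → ℝ) (hy : y = fun t => (∑ i, X i t * α i) + ε t)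
    -- the quadratic loss
    (L : (Fin n → ℝ) → ℝ)
    (hL : L = fun β => (1 / (2 * (T : ℝ))) * ∑ t, (y t - ∑ i, X i t * β i) ^ 2)
    -- its gradient
    (gradL : (Fin n → ℝ) → Fin n → ℝ)
    (hgrad : gradL = fun β j => -(1 / (T : ℝ)) * ∑ t, X j t * (y t - ∑ i, X i t * β i))
    -- ℓ is a norm on ℝⁿ
    (ℓ : (Fin n → ℝ) → ℝ)
    (hℓ_nonneg : ∀ v, 0 ≤ ℓ v)
    (hℓ_homog : ∀ (c : ℝ) (v), ℓ (c • v) = |c| * ℓ v)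
    (hℓ_triangle : ∀ v w, ℓ (v + w) ≤ ℓ v + ℓ w)
    (hℓ_eq_zero : ∀ v, ℓ v = 0 → v = 0)
    -- A is a linear subspace with Euclidean orthogonal complement Aperp
    (A Aperp : Submodule ℝ (Fin n → ℝ))
    (hAperp : (Aperp : Set (Fin n → ℝ)) = {v : Fin n → ℝ | ∀ a ∈ A, ∑ i, a i * v i = 0})
    -- ℓ is decomposable with respect to (A, Aperp)
    (hdecomp : ∀ a ∈ A, ∀ b ∈ Aperp, ℓ (a + b) = ℓ a + ℓ b)
    -- the true coefficient vector lies in A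
    (hαA : α ∈ A)
    -- the dual norm of ℓ
    (dual : (Fin n → ℝ) → ℝ)
    (hdual : dual = fun v => sSup ((fun u => (∑ i, u i * v i) / ℓ u) '' {u : Fin n → ℝ | u ≠ 0}))
    -- the subspace compatibility constant
    (Ψ : ℝ)
    (hΨ : Ψ = sSup ((fun u => ℓ u / e2norm u) '' {u : Fin n → ℝ | u ∈ A ∧ u ≠ 0}))
    -- the penalty parameter
    (lam : ℝ) (hlam_pos : 0 < lam)
    (hlam : lam ≥ 2 * dual (fun j => (1 / (T : ℝ)) * ∑ t, X j t * ε t))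
    -- strong convexity of L with parameter γ
    (γ : ℝ) (hγ : 0 < γ)
    (hsc : ∀ a b : Fin n → ℝ,
      L b - L a ≥ (∑ j, gradL a j * (b j - a j)) + (γ / 2) * ∑ i, (b i - a i) ^ 2)
    -- α̂ minimizes the penalized objective
    (αhat : Fin n → ℝ)
    (hmin : ∀ β : Fin n → ℝ, L αhat + lam * ℓ αhat ≤ L β + lam * ℓ β) :
    e2norm (αhat - α) ≤ 3 * (lam / γ) * Ψ := by
  have hbdd_dual : ∀ u v, ∑ i, u i * v i ≤ dual v * ℓ u := by
    intro u v
    rcases eq_or_ne u 0 with rfl | hu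
    · simp [map_zero_of_smul_eq_abs_mul hℓ_homog]
    have hpos : ∀ {u}, u ≠ 0 → 0 < ℓ u := fun {u} hu =>
      (hℓ_nonneg u).lt_of_ne fun h => hu (hℓ_eq_zero u h.symm)
    obtain ⟨C, hC⟩ := exists_linear_le_mul_norm hℓ_nonneg hℓ_homog hℓ_triangle hℓ_eq_zero
      (∑ i, v i • LinearMap.proj i : (Fin n → ℝ) →ₗ[ℝ] ℝ)
    rw [← div_le_iff₀ (hpos hu), hdual]
    refine le_csSup ⟨C, ?_⟩ ⟨u, hu, rfl⟩
    rintro _ ⟨w, hw, rfl⟩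
    rw [div_le_iff₀ (hpos hw)]
    simpa [mul_comm] using hC w
  have hΨ_bound : ∀ u ∈ A, ℓ u ≤ Ψ * e2norm u := by
    intro u huA
    rcases eq_or_ne u 0 with rfl | hu
    · simp [map_zero_of_smul_eq_abs_mul hℓ_homog, e2norm]
    obtain ⟨C, hC⟩ := exists_norm_le_mul_e2norm hℓ_nonneg hℓ_homog hℓ_triangle
    rw [← div_le_iff₀ (e2norm_pos hu), hΨ]
    refine le_csSup ⟨C, ?_⟩ ⟨u, ⟨huA, hu⟩, rfl⟩
    rintro _ ⟨w, hw, rfl⟩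
    rw [div_le_iff₀ (e2norm_pos hw.2)]
    exact hC w
  have hΨ_nonneg : 0 ≤ Ψ := by
    rw [hΨ]
    refine Real.sSup_nonneg ?_
    rintro _ ⟨w, -, rfl⟩
    exact div_nonneg (hℓ_nonneg w) (e2norm_nonneg w)
  obtain ⟨a, ha, b, hb, hab⟩ := exists_add_mem_forall_sum_mul_eq_zero A (αhat - α)
  have hbA : b ∈ Aperp := by
    rw [← SetLike.mem_coe, hAperp]
    exact hb
  have hgrad_α : gradL α = fun j => -((1 / (T : ℝ)) * ∑ t, X j t * ε t) := by
    subst hgrad hy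
    ext j
    simp
  have hgrad_lower : -(lam / 2 * ℓ (αhat - α)) ≤ ∑ j, gradL α j * (αhat j - α j) := by
    have h := hbdd_dual (αhat - α) (fun j => (1 / (T : ℝ)) * ∑ t, X j t * ε t)
    have hsum : ∑ j, gradL α j * (αhat j - α j)
        = -∑ j, (αhat - α) j * ((1 / (T : ℝ)) * ∑ t, X j t * ε t) := by
      rw [hgrad_α, ← Finset.sum_neg_distrib]
      exact Finset.sum_congr rfl fun j _ => by simp only [Pi.sub_apply]; ring
    have hle := mul_le_mul_of_nonneg_right hlam (hℓ_nonneg (αhat - α))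
    rw [hsum]
    linarith
  have hℓ_diff : ℓ (αhat - α) = ℓ a + ℓ b := by rw [hab, hdecomp a ha b hbA]
  have hℓ_hat : ℓ αhat = ℓ (α + a) + ℓ b := by
    rw [← hdecomp _ (A.add_mem hαA ha) b hbA, add_assoc, ← hab, add_sub_cancel]
  have hℓ_α : ℓ α ≤ ℓ (α + a) + ℓ a := by
    have h1 := hℓ_triangle (α + a) ((-1 : ℝ) • a)
    rw [hℓ_homog] at h1
    simpa using h1
  have hsq : ∑ i, (αhat i - α i) ^ 2 = e2norm (αhat - α) ^ 2 := (e2norm_sq _).symm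
  have hconv := hsc α αhat
  rw [hsq] at hconv
  rw [hℓ_diff] at hgrad_lower
  have hpen : lam * (ℓ α - ℓ a + ℓ b) ≤ lam * ℓ αhat :=
    mul_le_mul_of_nonneg_left (by linarith) hlam_pos.le
  have hℓb := mul_nonneg hlam_pos.le (hℓ_nonneg b)
  have hquad : γ * e2norm (αhat - α) ^ 2 ≤ 3 * lam * ℓ a := by
    linarith [hmin α]
  have hℓa : ℓ a ≤ Ψ * e2norm (αhat - α) := by
    rw [hab]
    exact (hΨ_bound a ha).trans
      (mul_le_mul_of_nonneg_left (e2norm_le_e2norm_add (hb a ha)) hΨ_nonneg)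
  have hmain : (γ * e2norm (αhat - α)) * e2norm (αhat - α)
      ≤ (3 * lam * Ψ) * e2norm (αhat - α) := by
    have := mul_le_mul_of_nonneg_left hℓa (by positivity : 0 ≤ 3 * lam)
    linarith
  have hrhs : 3 * (lam / γ) * Ψ = 3 * lam * Ψ / γ := by ring
  rcases (e2norm_nonneg (αhat - α)).eq_or_lt with h0 | hpos
  · rw [← h0]
    positivity
  · rw [hrhs, le_div_iff₀ hγ, mul_comm]
    exact le_of_mul_le_mul_right hmain hpos
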